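/- Let T be a triangulated category, let w : Z → M be a morphism and ν₁, ν₂ : Z → Z endomorphisms. Suppose given distinguished triangles Z → Z ⊕ M → G₂ → Z⟦1⟧ with first map of components ν₂ and w, and second map of components r₂ : Z → G₂ and s₂ : M → G₂ (so G₂ is the homotopy pushout Ged(w,ν₂)), and Z → Z ⊕ M → G₁₂ → Z⟦1⟧ with first map of components ν₁∘ν₂ and w, and second map of components r₁₂ : Z → G₁₂ and s₁₂ : M → G₁₂ (so G₁₂ = Ged(w, ν₁ν₂)). Then there exists a morphism f : G₂ → G₁₂ with f ∘ s₂ = s₁₂ such that the triangle Z → Z ⊕ G₂ → G₁₂ → Z⟦1⟧, whose first map has components ν₁ and r₂ and whose second map has components r₁₂ and −f, is distinguished. Hence G₂ ≤_Δ G₁₂, and G₂ ≤_{Δ+nil} G₁₂ when ν₁ is nilpotent; moreover Ged(w, ν₁ν₂) is the homotopy pushout Ged(r₂, ν₁). -/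

import Mathlib

open CategoryTheory Category Limits Pretriangulated

/-- An endomorphism `v` of `Z` is nilpotent if some positive power of it
(in the endomorphism ring `End Z`) vanishes. -/
def IsNilpotentEndo {T : Type*} [Category T] [Preadditive T] {Z : T} (v : Z ⟶ Z) : Prop :=
  ∃ n : ℕ, 0 < n ∧ (show End Z from v) ^ n = 0

/-- `M ≤_Δ N` : there are an object `W` and a distinguished triangle
`W → W ⊕ M → N → W⟦1⟧` whose first morphism has components `v : W ⟶ W` and
`u : W ⟶ M`. -/
def Deg (T : Type*) [Category T] [Preadditive T] [HasZeroObject T] [HasShift T ℤ]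
    [∀ n : ℤ, (shiftFunctor T n).Additive] [Pretriangulated T] [HasBinaryBiproducts T]
    (M N : T) : Prop :=
  ∃ (W : T) (v : W ⟶ W) (u : W ⟶ M) (g : W ⊞ M ⟶ N) (h : N ⟶ W⟦(1 : ℤ)⟧),
    Triangle.mk (biprod.lift v u) g h ∈ distTriang T

/-- `M ≤_{Δ+nil} N` : as in `Deg`, with the endomorphism component nilpotent. -/
def DegNil (T : Type*) [Category T] [Preadditive T] [HasZeroObject T] [HasShift T ℤ]
    [∀ n : ℤ, (shiftFunctor T n).Additive] [Pretriangulated T] [HasBinaryBiproducts T]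
    (M N : T) : Prop :=
  ∃ (W : T) (v : W ⟶ W) (u : W ⟶ M) (g : W ⊞ M ⟶ N) (h : N ⟶ W⟦(1 : ℤ)⟧),
    IsNilpotentEndo v ∧ Triangle.mk (biprod.lift v u) g h ∈ distTriang T

/-- Adding the split triangle `0 ⟶ C ⟶ C ⟶ 0` to a distinguished triangle gives a
distinguished triangle. -/
lemma distinguished_biprod_map_id {T : Type*} [Category T] [Preadditive T] [HasZeroObject T]
    [HasShift T ℤ] [∀ n : ℤ, (shiftFunctor T n).Additive] [Pretriangulated T] [IsTriangulated T]
    [HasBinaryBiproducts T] {X Y Z : T} (C : T) {f : X ⟶ Y} {g : Y ⟶ Z} {h : Z ⟶ X⟦(1 : ℤ)⟧}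
    (hT : Triangle.mk f g h ∈ distTriang T) :
    Triangle.mk (f ≫ biprod.inl) (biprod.map g (𝟙 C)) (biprod.fst ≫ h) ∈ distTriang T := by
  obtain ⟨E, v, k, hE⟩ := distinguished_cocone_triangle (f ≫ (biprod.inl : Y ⟶ Y ⊞ C))
  let o := Triangulated.someOctahedron rfl hT (binaryBiproductTriangle_distinguished Y C) hE
  have hv : v ≫ o.m₃ = biprod.snd := o.comm₃
  have hg : g ≫ o.m₁ = biprod.inl ≫ v := o.comm₁
  have hk : o.m₁ ≫ k = h := o.comm₂
  have hm : o.m₁ ≫ o.m₃ = 0 := comp_distTriang_mor_zero₁₂ _ o.mem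
  have hvk : v ≫ k = 0 := comp_distTriang_mor_zero₂₃ _ hE
  let d : Z ⊞ C ⟶ E := biprod.desc o.m₁ (biprod.inr ≫ v)
  have hd₁ : biprod.inl ≫ d = 𝟙 Z ≫ o.m₁ := by simp [d]
  have hd₂ : biprod.snd ≫ 𝟙 C = d ≫ o.m₃ := by
    ext <;> simp [d, hm, hv]
  have hd : IsIso d :=
    isIso₂_of_isIso₁₃ (Triangle.homMk (binaryBiproductTriangle Z C) (Triangle.mk o.m₁ o.m₃ _)
      (𝟙 Z) d (𝟙 C) hd₁ hd₂ (zero_comp.trans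
        (((congrArg _ zero_comp).trans comp_zero).symm)))
      (binaryBiproductTriangle_distinguished Z C) o.mem
      (inferInstanceAs (IsIso (𝟙 Z))) (inferInstanceAs (IsIso (𝟙 C)))
  let ε : Z ⊞ C ≅ E := asIso d
  have hv' : biprod.map g (𝟙 C) ≫ d = v := by
    ext <;> simp [d, hg]
  have hk' : biprod.fst ≫ h = d ≫ k := by
    ext <;> simp [d, hk, hvk]
  exact isomorphic_distinguished _ hE _ (Triangle.isoMk _ _ (Iso.refl X) (Iso.refl (Y ⊞ C))
    ε ((comp_id _).trans (id_comp _).symm) (hv'.trans (id_comp _).symm)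
    (((congrArg _ (CategoryTheory.Functor.map_id _ _)).trans (comp_id _)).trans hk'))

/-- Pasting of homotopy pushouts: if `G` is the homotopy pushout of `w : A ⟶ M` along
`ν : A ⟶ B` and `H` that of `w` along `ν ≫ μ`, then `H` is the homotopy pushout of
`r : B ⟶ G` along `μ : B ⟶ C`, compatibly with the maps from `M` and from `C`. -/
lemma exists_distinguished_of_homotopyPushout_comp {T : Type*} [Category T] [Preadditive T]
    [HasZeroObject T] [HasShift T ℤ] [∀ n : ℤ, (shiftFunctor T n).Additive] [Pretriangulated T]
    [IsTriangulated T] [HasBinaryBiproducts T] {A B C M G H : T}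
    {w : A ⟶ M} {ν : A ⟶ B} {μ : B ⟶ C} {r : B ⟶ G} {s : M ⟶ G} {h : G ⟶ A⟦(1 : ℤ)⟧}
    (hG : Triangle.mk (biprod.lift ν w) (biprod.desc r (-s)) h ∈ distTriang T)
    {r' : C ⟶ H} {s' : M ⟶ H} {h' : H ⟶ A⟦(1 : ℤ)⟧}
    (hH : Triangle.mk (biprod.lift (ν ≫ μ) w) (biprod.desc r' (-s')) h' ∈ distTriang T) :
    ∃ (f : G ⟶ H) (θ : H ⟶ B⟦(1 : ℤ)⟧), s ≫ f = s' ∧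
      Triangle.mk (biprod.lift μ r) (biprod.desc r' (-f)) θ ∈ distTriang T := by
  let i : A ⟶ B ⊞ (C ⊞ M) := biprod.lift ν (-biprod.lift (ν ≫ μ) w)
  let q : B ⊞ (C ⊞ M) ⟶ C ⊞ G :=
    biprod.desc (biprod.lift μ r) (biprod.map (𝟙 C) s)
  let e : B ⊞ (C ⊞ M) ≅ (B ⊞ M) ⊞ C :=
    { hom := biprod.desc (biprod.lift biprod.inl μ)
        (biprod.desc biprod.inr (-biprod.inr ≫ biprod.inl))
      inv := biprod.desc (biprod.desc (biprod.lift (𝟙 B) (-μ ≫ biprod.inl))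
        (-biprod.inr ≫ biprod.inr)) (biprod.inl ≫ biprod.inr)
      hom_inv_id := by
        ext <;> simp
      inv_hom_id := by
        ext <;> simp }
  have he₁ : i ≫ e.hom = biprod.lift ν w ≫ biprod.inl := by
    apply biprod.hom_ext
    · apply biprod.hom_ext <;> simp [i, e]
    · simp [i, e]
  have he₂ : q ≫ (biprod.braiding C G).hom =
      e.hom ≫ biprod.map (biprod.desc r (-s)) (𝟙 C) := by
    ext <;> simp [q, e]
  have he₃ : biprod.snd ≫ h = (biprod.braiding C G).hom ≫ biprod.fst ≫ h := by
    simp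
  have hq : Triangle.mk i q (biprod.snd ≫ h) ∈ distTriang T :=
    isomorphic_distinguished _ (distinguished_biprod_map_id C hG) _
      (Triangle.isoMk _ _ (Iso.refl A) e (biprod.braiding C G)
        (he₁.trans (id_comp _).symm) he₂
        (((congrArg _ (CategoryTheory.Functor.map_id _ _)).trans (comp_id _)).trans he₃))
  obtain ⟨X, g, θ, hX⟩ := distinguished_cocone_triangle (biprod.lift μ r)
  let o := Triangulated.someOctahedron (show biprod.inl ≫ q = biprod.lift μ r by simp [q])
    (binaryBiproductTriangle_distinguished B (C ⊞ M)) (rot_of_distTriang _ hq) hX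
  have hi : i ≫ biprod.snd = -biprod.lift (ν ≫ μ) w := biprod.lift_snd _ _
  have hδ : ((-i⟦(1 : ℤ)⟧') ≫ (biprod.snd : B ⊞ (C ⊞ M) ⟶ C ⊞ M)⟦(1 : ℤ)⟧') ≫
      (𝟙 (C ⊞ M))⟦(1 : ℤ)⟧' =
        (-𝟙 (A⟦(1 : ℤ)⟧)) ≫ (-(biprod.lift (ν ≫ μ) w)⟦(1 : ℤ)⟧') := by
    rw [Preadditive.neg_comp, ← Functor.map_comp, hi]
    simp
  obtain ⟨b, hb₁, hb₂⟩ : ∃ b : X ⟶ H, o.m₁ ≫ b = 𝟙 (C ⊞ M) ≫ biprod.desc r' (-s') ∧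
      o.m₃ ≫ (-𝟙 (A⟦(1 : ℤ)⟧)) = b ≫ h' :=
    complete_distinguished_triangle_morphism₂ _ _ o.mem
      (rot_of_distTriang _ hH) (𝟙 (C ⊞ M)) (-𝟙 (A⟦(1 : ℤ)⟧)) hδ
  have hneg : IsIso (-𝟙 (A⟦(1 : ℤ)⟧)) := ⟨-𝟙 (A⟦(1 : ℤ)⟧), by simp, by simp⟩
  have hb : IsIso b :=
    isIso₂_of_isIso₁₃ (Triangle.homMk (Triangle.mk o.m₁ o.m₃ _) (Triangle.mk _ _ _).rotate
      (𝟙 (C ⊞ M)) b (-𝟙 (A⟦(1 : ℤ)⟧)) hb₁ hb₂ hδ) o.mem (rot_of_distTriang _ hH)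
      (inferInstanceAs (IsIso (𝟙 (C ⊞ M))))
      hneg
  let β : X ≅ H := asIso b
  have ho : biprod.snd ≫ o.m₁ = q ≫ g := o.comm₁
  have hgb : q ≫ g ≫ b = biprod.snd ≫ biprod.desc r' (-s') := by
    rw [← assoc, ← ho, assoc, hb₁, id_comp]
  have hr' : biprod.inl ≫ g ≫ b = r' := by
    simpa [q] using congrArg (fun k => biprod.inl ≫ biprod.inr ≫ k) hgb
  have hs' : s ≫ biprod.inr ≫ g ≫ b = -s' := by
    simpa [q] using congrArg (fun k => biprod.inr ≫ biprod.inr ≫ k) hgb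
  have hdesc : g ≫ b = biprod.desc r' (-(-(biprod.inr ≫ g ≫ b))) := by
    ext <;> simp [hr']
  refine ⟨-(biprod.inr ≫ g ≫ b), β.inv ≫ θ, by simp [hs'], ?_⟩
  rw [← hdesc]
  exact isomorphic_distinguished _ hX _ (Triangle.isoMk _ _ (Iso.refl B) (Iso.refl (C ⊞ G))
    β.symm ((comp_id _).trans (id_comp _).symm)
    (((assoc _ _ _).trans ((congrArg _ β.hom_inv_id).trans (comp_id _))).trans (id_comp _).symm)
    (((congrArg _ (CategoryTheory.Functor.map_id _ _)).trans (comp_id _))))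

/-- given `w : Z ⟶ M`, endomorphisms `ν₁, ν₂` of `Z`, a homotopy pushout
`G₂ = Ged(w, ν₂)` (distinguished triangle `Z → Z ⊕ M → G₂ → Z⟦1⟧`, first map of
components `ν₂, w`, second map of components `r₂, −s₂`) and a homotopy pushout
`G₁₂ = Ged(w, ν₁ν₂)` (first map of components `ν₁ ∘ ν₂, w`, second map of components
`r₁₂, −s₁₂`), there is `f : G₂ ⟶ G₁₂` with `f ∘ s₂ = s₁₂` such that the triangle
`Z → Z ⊕ G₂ → G₁₂ → Z⟦1⟧` with first map of components `ν₁, r₂` and second map of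
components `r₁₂, −f` is distinguished (i.e. `G₁₂ = Ged(r₂, ν₁)`). Hence
`G₂ ≤_Δ G₁₂`, and `G₂ ≤_{Δ+nil} G₁₂` when `ν₁` is nilpotent. -/
theorem stmt4 {T : Type*} [Category T] [Preadditive T] [HasZeroObject T] [HasShift T ℤ]
    [∀ n : ℤ, (shiftFunctor T n).Additive] [Pretriangulated T] [IsTriangulated T]
    [HasBinaryBiproducts T]
    (Z M : T) (w : Z ⟶ M) (ν₁ ν₂ : Z ⟶ Z)
    (G₂ : T) (r₂ : Z ⟶ G₂) (s₂ : M ⟶ G₂) (h₂ : G₂ ⟶ Z⟦(1 : ℤ)⟧)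
    (hT₂ : Triangle.mk (biprod.lift ν₂ w) (biprod.desc r₂ (-s₂)) h₂ ∈ distTriang T)
    (G₁₂ : T) (r₁₂ : Z ⟶ G₁₂) (s₁₂ : M ⟶ G₁₂) (h₁₂ : G₁₂ ⟶ Z⟦(1 : ℤ)⟧)
    (hT₁₂ : Triangle.mk (biprod.lift (ν₂ ≫ ν₁) w) (biprod.desc r₁₂ (-s₁₂)) h₁₂ ∈
      distTriang T) :
    (∃ (f : G₂ ⟶ G₁₂) (θ : G₁₂ ⟶ Z⟦(1 : ℤ)⟧),
        s₂ ≫ f = s₁₂ ∧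
        Triangle.mk (biprod.lift ν₁ r₂) (biprod.desc r₁₂ (-f)) θ ∈ distTriang T) ∧
      Deg T G₂ G₁₂ ∧ (IsNilpotentEndo ν₁ → DegNil T G₂ G₁₂) := by
  obtain ⟨f, θ, hf, hθ⟩ := exists_distinguished_of_homotopyPushout_comp hT₂ hT₁₂
  exact ⟨⟨f, θ, hf, hθ⟩, ⟨Z, ν₁, r₂, _, θ, hθ⟩, fun hν => ⟨Z, ν₁, r₂, _, θ, hν, hθ⟩⟩
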